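/- arXiv:1003.5059 — 2 statements merged into one kernel-verified Lean document; each statement's English description precedes it below -/
import Mathlib

section
/- Let β ≥ 0, α > -1, p ≥ 1 with δ := 2 + β - (2+α)/p > 0, and for λ in the unit disc let F_{λ,β}(z) = (1 - conj(λ)z)^{-(1+β)}. Then ‖F_{λ,β}‖_{D^p_α}^p ≍ (1-|λ|²)^{-pδ}, i.e. there are constants C₁, C₂ > 0 independent of λ with C₁(1-|λ|²)^{-pδ} ≤ |F_{λ,β}(0)|^p + ∫_D |F'_{λ,β}(z)|^p dA_α(z) ≤ C₂(1-|λ|²)^{-pδ}. -/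
open MeasureTheory Metric

/-- The integral `∫₀^∞ max(t,u)^{-σ} u^γ du` is finite and scales like `t^{γ+1-σ}`. -/
lemma lintegral_max_rpow_mul_rpow_le {σ γ t : ℝ} (hγ : -1 < γ) (hσ : γ + 1 < σ) (ht : 0 < t) :
    ∫⁻ u in Set.Ioi (0 : ℝ), ENNReal.ofReal (max t u ^ (-σ) * u ^ γ) ≤
      ENNReal.ofReal ((1 / (γ + 1) + 1 / (σ - γ - 1)) * t ^ (γ + 1 - σ)) := by
  have near : ∫⁻ u in Set.Ioc 0 t, ENNReal.ofReal (max t u ^ (-σ) * u ^ γ) =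
      ENNReal.ofReal (1 / (γ + 1) * t ^ (γ + 1 - σ)) := by
    have hi : IntegrableOn (fun u : ℝ => t ^ (-σ) * u ^ γ) (Set.Ioc 0 t) :=
      ((intervalIntegrable_iff_integrableOn_Ioc_of_le ht.le).1
        (intervalIntegral.intervalIntegrable_rpow' hγ)).const_mul _
    have hval : ∫ u in Set.Ioc 0 t, t ^ (-σ) * u ^ γ = 1 / (γ + 1) * t ^ (γ + 1 - σ) := by
      rw [integral_const_mul, ← intervalIntegral.integral_of_le ht.le, integral_rpow (Or.inl hγ),
        Real.zero_rpow (by linarith), show γ + 1 - σ = -σ + (γ + 1) by ring, Real.rpow_add ht (-σ)]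
      ring
    rw [← hval, ofReal_integral_eq_lintegral_ofReal hi]
    · refine setLIntegral_congr_fun measurableSet_Ioc fun u hu => ?_
      simp only [max_eq_left hu.2]
    · filter_upwards [ae_restrict_mem measurableSet_Ioc] with u hu
      have := hu.1
      simp only [Pi.zero_apply]
      positivity
  have far : ∫⁻ u in Set.Ioi t, ENNReal.ofReal (max t u ^ (-σ) * u ^ γ) =
      ENNReal.ofReal (1 / (σ - γ - 1) * t ^ (γ + 1 - σ)) := by
    have hval : ∫ u in Set.Ioi t, u ^ (-σ + γ) = 1 / (σ - γ - 1) * t ^ (γ + 1 - σ) := by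
      rw [integral_Ioi_rpow_of_lt (by linarith) ht, show -σ + γ + 1 = γ + 1 - σ by ring,
        neg_div, ← div_neg, show -(γ + 1 - σ) = σ - γ - 1 by ring]
      ring
    rw [← hval, ofReal_integral_eq_lintegral_ofReal
      (integrableOn_Ioi_rpow_of_lt (by linarith) ht)]
    · refine setLIntegral_congr_fun measurableSet_Ioi fun u hu => ?_
      have hu' : t < u := hu
      simp only [max_eq_right hu'.le, Real.rpow_add (ht.trans hu')]
    · filter_upwards [ae_restrict_mem measurableSet_Ioi] with u hu
      have : 0 < u := ht.trans hu
      simp only [Pi.zero_apply]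
      positivity
  rw [← Set.Ioc_union_Ioi_eq_Ioi ht.le]
  refine (lintegral_union_le _ _ _).trans ?_
  have h1 : 0 < γ + 1 := by linarith
  have h2 : 0 < σ - γ - 1 := by linarith
  rw [near, far, add_mul, ENNReal.ofReal_add (by positivity) (by positivity)]

lemma lintegral_max_abs_rpow_le {σ t : ℝ} (hσ : 1 < σ) (ht : 0 < t) :
    ∫⁻ x : ℝ, ENNReal.ofReal (max t |x| ^ (-σ)) ≤
      ENNReal.ofReal (2 * (1 + 1 / (σ - 1)) * t ^ (1 - σ)) := by
  have half : ∫⁻ x in Set.Ioi (0 : ℝ), ENNReal.ofReal (max t |x| ^ (-σ)) ≤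
      ENNReal.ofReal ((1 + 1 / (σ - 1)) * t ^ (1 - σ)) := by
    have h := lintegral_max_rpow_mul_rpow_le (σ := σ) (γ := 0) (by norm_num) (by linarith) ht
    simp only [zero_add, sub_zero, div_one, Real.rpow_zero, mul_one] at h
    refine le_trans (le_of_eq ?_) h
    exact setLIntegral_congr_fun measurableSet_Ioi fun x hx => by
      simp only [abs_of_pos (Set.mem_Ioi.1 hx)]
  have reflect : ∫⁻ x in Set.Iic (0 : ℝ), ENNReal.ofReal (max t |x| ^ (-σ)) =
      ∫⁻ x in Set.Ioi (0 : ℝ), ENNReal.ofReal (max t |x| ^ (-σ)) := by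
    have h := (Measure.measurePreserving_neg (volume : Measure ℝ)).setLIntegral_comp_preimage_emb
      (MeasurableEquiv.neg ℝ).measurableEmbedding
      (fun x => ENNReal.ofReal (max t |x| ^ (-σ))) (Set.Ici 0)
    simp only [abs_neg] at h
    rw [setLIntegral_congr Ioi_ae_eq_Ici, ← h]
    simp
  rw [← lintegral_add_compl _ (measurableSet_Iic (a := (0 : ℝ))), Set.compl_Iic, reflect]
  have h2 : 0 < σ - 1 := by linarith
  refine (add_le_add half half).trans (le_of_eq ?_)
  rw [← ENNReal.ofReal_add (by positivity) (by positivity)]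
  ring_nf

lemma abs_div_pi_le_norm_one_sub {x θ : ℝ} (hx : 0 ≤ x) (hθ : |θ| ≤ Real.pi) :
    |θ| / Real.pi ≤ ‖(1 : ℂ) - x * (Real.cos θ + Real.sin θ * Complex.I)‖ := by
  have hre : ((1 : ℂ) - x * (Real.cos θ + Real.sin θ * Complex.I)).re = 1 - x * Real.cos θ := by
    simp [-Complex.ofReal_cos, -Complex.ofReal_sin]
  have him : ((1 : ℂ) - x * (Real.cos θ + Real.sin θ * Complex.I)).im = -(x * Real.sin θ) := by
    simp [-Complex.ofReal_cos, -Complex.ofReal_sin]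
  rcases le_total |θ| (Real.pi / 2) with h | h
  · have hs := Real.mul_abs_le_abs_sin h
    have hle : |θ| / Real.pi ≤ |Real.sin θ| := by
      refine le_trans ?_ hs
      rw [div_mul_eq_mul_div]
      gcongr
      linarith [abs_nonneg θ]
    refine hle.trans (abs_le_of_sq_le_sq ?_ (norm_nonneg _))
    rw [Complex.sq_norm, Complex.normSq_apply, hre, him]
    nlinarith [Real.sin_sq_add_cos_sq θ, sq_nonneg (x - Real.cos θ)]
  · have hc : Real.cos θ ≤ 0 := by
      rw [← Real.cos_abs]
      exact Real.cos_nonpos_of_pi_div_two_le_of_le h (by linarith [Real.pi_pos])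
    calc |θ| / Real.pi ≤ 1 := (div_le_one Real.pi_pos).2 hθ
      _ ≤ 1 - x * Real.cos θ := by nlinarith
      _ ≤ _ := by rw [← hre]; exact Complex.re_le_norm _

lemma one_sub_sq_rpow_le {x α : ℝ} (hx : 0 ≤ x) (hx1 : x < 1) :
    (1 - x ^ 2) ^ α ≤ 2 ^ |α| * (1 - x) ^ α := by
  rw [show 1 - x ^ 2 = (1 + x) * (1 - x) by ring,
    Real.mul_rpow (by linarith) (by linarith)]
  have h0 : 0 ≤ 1 - x := by linarith
  gcongr
  calc (1 + x) ^ α ≤ (1 + x) ^ |α| :=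
        Real.rpow_le_rpow_of_exponent_le (by linarith) (le_abs_self α)
    _ ≤ 2 ^ |α| := by gcongr; linarith

lemma kernel_polar_le {a x θ α σ τ : ℝ} (ha : 0 ≤ a) (ha1 : a < 1) (hx : 0 ≤ x) (hx1 : x < 1)
    (hθ : |θ| ≤ Real.pi) (hσ : 0 ≤ σ) (hτ : 0 ≤ τ) :
    ‖(1 : ℂ) - a * (x * (Real.cos θ + Real.sin θ * Complex.I))‖ ^ (-(σ + τ)) * (1 - x ^ 2) ^ α ≤
      Real.pi ^ σ * 2 ^ |α| * ((max (1 - a) (1 - x) ^ (-τ) * (1 - x) ^ α) *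
        max (1 - a) |θ| ^ (-σ)) := by
  set N := ‖(1 : ℂ) - a * (x * (Real.cos θ + Real.sin θ * Complex.I))‖ with hN
  have hpi := Real.pi_pos
  have ht : 0 < 1 - a := by linarith
  have hu : 0 < 1 - x := by linarith
  have hrad : 1 - a * x ≤ N := by
    have h := norm_sub_norm_le (1 : ℂ) (a * (x * (Real.cos θ + Real.sin θ * Complex.I)))
    have h1 : ‖(Real.cos θ + Real.sin θ * Complex.I : ℂ)‖ = 1 := by
      rw [Complex.ofReal_cos, Complex.ofReal_sin, Complex.norm_cos_add_sin_mul_I]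
    rw [norm_mul, norm_mul, h1, Complex.norm_real, Complex.norm_real, Real.norm_of_nonneg ha,
      Real.norm_of_nonneg hx, norm_one, mul_one] at h
    exact h
  have hta : 1 - a ≤ N := by nlinarith
  have hang : |θ| / Real.pi ≤ N := by
    have h := abs_div_pi_le_norm_one_sub (mul_nonneg ha hx) hθ
    rwa [Complex.ofReal_mul, mul_assoc] at h
  have hτN : N ^ (-τ) ≤ max (1 - a) (1 - x) ^ (-τ) :=
    Real.rpow_le_rpow_of_nonpos (lt_max_of_lt_left ht) (max_le hta (by nlinarith)) (by linarith)
  have hσN : N ^ (-σ) ≤ Real.pi ^ σ * max (1 - a) |θ| ^ (-σ) := by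
    have hm : 0 < max (1 - a) |θ| := lt_max_of_lt_left ht
    have hle : max (1 - a) |θ| / Real.pi ≤ N := by
      rw [div_le_iff₀ hpi]
      refine max_le ?_ ((div_le_iff₀ hpi).1 hang)
      nlinarith [Real.two_le_pi]
    refine (Real.rpow_le_rpow_of_nonpos (by positivity) hle (by linarith)).trans (le_of_eq ?_)
    rw [Real.div_rpow hm.le hpi.le, Real.rpow_neg hpi.le, div_inv_eq_mul, mul_comm]
  have hNpos : 0 < N := ht.trans_le hta
  rw [neg_add, Real.rpow_add hNpos]
  calc N ^ (-σ) * N ^ (-τ) * (1 - x ^ 2) ^ α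
      ≤ (Real.pi ^ σ * max (1 - a) |θ| ^ (-σ)) * max (1 - a) (1 - x) ^ (-τ) *
          (2 ^ |α| * (1 - x) ^ α) := by
        have : 0 ≤ 1 - x ^ 2 := by nlinarith
        gcongr
        exact one_sub_sq_rpow_le hx hx1
    _ = _ := by ring

lemma measurable_kernel (l : ℂ) (s α : ℝ) :
    Measurable fun z : ℂ => ‖(1 : ℂ) - l * z‖ ^ (-s) * (1 - ‖z‖ ^ 2) ^ α := by
  fun_prop

lemma lintegral_kernel_ofReal_le {a α σ τ : ℝ} (ha : 0 ≤ a) (ha1 : a < 1) (hα : -1 < α)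
    (hσ : 1 < σ) (hτ : α + 1 < τ) :
    ∫⁻ z in ball (0 : ℂ) 1, ENNReal.ofReal
        (‖(1 : ℂ) - a * z‖ ^ (-(σ + τ)) * (1 - ‖z‖ ^ 2) ^ α) ≤
      ENNReal.ofReal (Real.pi ^ σ * 2 ^ |α| * ((1 / (α + 1) + 1 / (τ - α - 1)) *
        (2 * (1 + 1 / (σ - 1)))) * (1 - a) ^ (α + 2 - (σ + τ))) := by
  have ht : 0 < 1 - a := by linarith
  have hτ0 : 0 < τ - α - 1 := by linarith
  have hσ0 : 0 < σ - 1 := by linarith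
  have hα0 : 0 < α + 1 := by linarith
  set A : ℝ → ENNReal := (Set.Ioi 0).indicator fun u =>
    ENNReal.ofReal (max (1 - a) u ^ (-τ) * u ^ α) with hA
  set B : ℝ → ENNReal := fun θ => ENNReal.ofReal (max (1 - a) |θ| ^ (-σ)) with hB
  set K : ℝ := Real.pi ^ σ * 2 ^ |α| with hK
  have hAm : Measurable A := Measurable.indicator (by fun_prop) measurableSet_Ioi
  have hBm : Measurable B := by fun_prop
  have hKpos : 0 ≤ K := by positivity
  have hAint : ∫⁻ x, A (1 - x) ≤
      ENNReal.ofReal ((1 / (α + 1) + 1 / (τ - α - 1)) * (1 - a) ^ (α + 1 - τ)) := by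
    rw [lintegral_sub_left_eq_self, lintegral_indicator measurableSet_Ioi]
    exact lintegral_max_rpow_mul_rpow_le hα hτ ht
  have hpolar : ∀ q ∈ polarCoord.target, ENNReal.ofReal q.1 • (ball (0 : ℂ) 1).indicator
      (fun z => ENNReal.ofReal (‖(1 : ℂ) - a * z‖ ^ (-(σ + τ)) * (1 - ‖z‖ ^ 2) ^ α))
        (Complex.polarCoord.symm q) ≤ ENNReal.ofReal K * (A (1 - q.1) * B q.2) := by
    rintro ⟨x, θ⟩ hq
    rw [polarCoord_target] at hq
    obtain ⟨hx, hθ⟩ := hq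
    have hx : 0 < x := hx
    have hnorm : ‖Complex.polarCoord.symm (x, θ)‖ = x := by
      rw [Complex.norm_polarCoord_symm, abs_of_pos hx]
    by_cases hx1 : x < 1
    · have hu : 0 < 1 - x := by linarith
      rw [Set.indicator_of_mem (by rwa [mem_ball_zero_iff, hnorm]), hA,
        Set.indicator_of_mem (Set.mem_Ioi.2 hu), hnorm, smul_eq_mul]
      simp only [hB]
      rw [← ENNReal.ofReal_mul hx.le, ← ENNReal.ofReal_mul (by positivity),
        ← ENNReal.ofReal_mul hKpos]
      refine ENNReal.ofReal_le_ofReal ?_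
      have h := kernel_polar_le (α := α) ha ha1 hx.le hx1 (abs_le.2 ⟨hθ.1.le, hθ.2.le⟩)
        (by linarith : 0 ≤ σ) (by linarith : 0 ≤ τ)
      rw [Complex.polarCoord_symm_apply]
      refine (mul_le_of_le_one_left ?_ hx1.le).trans h
      have : 0 ≤ 1 - x ^ 2 := by nlinarith
      positivity
    · rw [Set.indicator_of_notMem (by rwa [mem_ball_zero_iff, hnorm])]
      simp
  rw [← lintegral_indicator measurableSet_ball, ← Complex.lintegral_comp_polarCoord_symm]
  calc _ ≤ ∫⁻ q in polarCoord.target, ENNReal.ofReal K * (A (1 - q.1) * B q.2) :=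
        setLIntegral_mono' polarCoord.open_target.measurableSet hpolar
    _ ≤ ∫⁻ q : ℝ × ℝ, ENNReal.ofReal K * (A (1 - q.1) * B q.2) := setLIntegral_le_lintegral _ _
    _ = ENNReal.ofReal K * ((∫⁻ x, A (1 - x)) * ∫⁻ θ, B θ) := by
        rw [lintegral_const_mul _ (by fun_prop), Measure.volume_eq_prod,
          lintegral_prod_mul (f := fun x => A (1 - x)) (by fun_prop) (by fun_prop)]
    _ ≤ ENNReal.ofReal K *
          (ENNReal.ofReal ((1 / (α + 1) + 1 / (τ - α - 1)) * (1 - a) ^ (α + 1 - τ)) *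
            ENNReal.ofReal (2 * (1 + 1 / (σ - 1)) * (1 - a) ^ (1 - σ))) := by
        gcongr
        exact lintegral_max_abs_rpow_le hσ ht
    _ = _ := by
        rw [← ENNReal.ofReal_mul (by positivity), ← ENNReal.ofReal_mul hKpos,
          show α + 2 - (σ + τ) = (α + 1 - τ) + (1 - σ) by ring, Real.rpow_add ht]
        ring_nf

lemma setLIntegral_ball_comp_mul_of_norm_eq_one (u : ℂ) (hu : ‖u‖ = 1) (f : ℂ → ENNReal) :
    ∫⁻ z in ball (0 : ℂ) 1, f (u * z) = ∫⁻ z in ball (0 : ℂ) 1, f z := by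
  set e := rotation ⟨u, mem_sphere_zero_iff_norm.2 hu⟩ with he
  have h := e.measurePreserving.setLIntegral_comp_preimage_emb
    e.toHomeomorph.measurableEmbedding f (ball (0 : ℂ) 1)
  rw [e.preimage_ball, map_zero] at h
  exact h

/-- The upper Forelli–Rudin estimate. -/
lemma exists_lintegral_kernel_le {α s : ℝ} (hα : -1 < α) (hs : α + 2 < s) :
    ∃ C : ℝ, 0 < C ∧ ∀ l ∈ ball (0 : ℂ) 1,
      ∫⁻ z in ball (0 : ℂ) 1, ENNReal.ofReal
          (‖(1 : ℂ) - (starRingEnd ℂ) l * z‖ ^ (-s) * (1 - ‖z‖ ^ 2) ^ α) ≤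
        ENNReal.ofReal (C * (1 - ‖l‖) ^ (α + 2 - s)) := by
  set ε := (s - (α + 2)) / 2 with hε
  have hε0 : 0 < ε := by linarith
  have hα0 : 0 < α + 1 := by linarith
  have hτ0 : 0 < (α + 1 + ε) - α - 1 := by linarith
  have hσ0 : 0 < (1 + ε) - 1 := by linarith
  refine ⟨Real.pi ^ (1 + ε) * 2 ^ |α| * ((1 / (α + 1) + 1 / ((α + 1 + ε) - α - 1)) *
    (2 * (1 + 1 / ((1 + ε) - 1)))), by have := Real.pi_pos; positivity, fun l hl => ?_⟩
  have hl1 : ‖l‖ < 1 := mem_ball_zero_iff.1 hl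
  obtain ⟨u, hu, hul⟩ : ∃ u : ℂ, ‖u‖ = 1 ∧ (starRingEnd ℂ) l * u = ‖l‖ := by
    rcases eq_or_ne l 0 with rfl | h0
    · exact ⟨1, by simp⟩
    · have hn : (‖l‖ : ℂ) ≠ 0 := by simpa using h0
      refine ⟨l / ‖l‖, by simp [h0], ?_⟩
      rw [← mul_div_assoc, Complex.conj_mul', sq, mul_div_assoc, div_self hn, mul_one]
  have h := lintegral_kernel_ofReal_le (norm_nonneg l) hl1 hα
    (by linarith : 1 < 1 + ε) (by linarith : α + 1 < α + 1 + ε)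
  rw [show 1 + ε + (α + 1 + ε) = s by rw [hε]; ring] at h
  rw [← setLIntegral_ball_comp_mul_of_norm_eq_one u hu]
  refine le_trans (le_of_eq ?_) h
  simp only [← mul_assoc, hul, norm_mul, hu, one_mul]

lemma kernel_nonneg {z : ℂ} (hz : z ∈ ball (0 : ℂ) 1) (l : ℂ) (s α : ℝ) :
    0 ≤ ‖(1 : ℂ) - l * z‖ ^ (-s) * (1 - ‖z‖ ^ 2) ^ α := by
  have hz1 : ‖z‖ < 1 := mem_ball_zero_iff.1 hz
  have : 0 ≤ 1 - ‖z‖ ^ 2 := by nlinarith [norm_nonneg z]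
  positivity

lemma exists_integral_kernel_le {α s : ℝ} (hα : -1 < α) (hs : α + 2 < s) :
    ∃ C : ℝ, 0 < C ∧ ∀ l ∈ ball (0 : ℂ) 1,
      IntegrableOn (fun z : ℂ => ‖(1 : ℂ) - (starRingEnd ℂ) l * z‖ ^ (-s) * (1 - ‖z‖ ^ 2) ^ α)
        (ball 0 1) ∧
      ∫ z in ball (0 : ℂ) 1, ‖(1 : ℂ) - (starRingEnd ℂ) l * z‖ ^ (-s) * (1 - ‖z‖ ^ 2) ^ α ≤
        C * (1 - ‖l‖) ^ (α + 2 - s) := by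
  obtain ⟨C, hC, h⟩ := exists_lintegral_kernel_le hα hs
  refine ⟨C, hC, fun l hl => ?_⟩
  have hmeas := (measurable_kernel ((starRingEnd ℂ) l) s α).aestronglyMeasurable
    (μ := volume.restrict (ball 0 1))
  have hnn : 0 ≤ᵐ[volume.restrict (ball (0 : ℂ) 1)] fun z : ℂ =>
      ‖(1 : ℂ) - (starRingEnd ℂ) l * z‖ ^ (-s) * (1 - ‖z‖ ^ 2) ^ α := by
    filter_upwards [ae_restrict_mem measurableSet_ball] with z hz
    exact kernel_nonneg hz _ s α
  refine ⟨⟨hmeas, ?_⟩, ?_⟩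
  · rw [hasFiniteIntegral_iff_ofReal hnn]
    exact (h l hl).trans_lt ENNReal.ofReal_lt_top
  · have hl1 : 0 < 1 - ‖l‖ := by linarith [mem_ball_zero_iff.1 hl]
    rw [integral_eq_lintegral_of_nonneg_ae hnn hmeas]
    exact ENNReal.toReal_le_of_le_ofReal (by positivity) (h l hl)

lemma min_mul_rpow_le {t x c d α : ℝ} (ht : 0 < t) (hc : 0 < c) (hcx : c * t ≤ x)
    (hxd : x ≤ d * t) : min (c ^ α) (d ^ α) * t ^ α ≤ x ^ α := by
  have hx : 0 < x := (mul_pos hc ht).trans_le hcx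
  have hd : 0 < d := pos_of_mul_pos_left (hx.trans_le hxd) ht.le
  rcases le_total 0 α with h | h
  · calc _ ≤ c ^ α * t ^ α := by gcongr; exact min_le_left _ _
      _ = (c * t) ^ α := (Real.mul_rpow hc.le ht.le).symm
      _ ≤ x ^ α := by gcongr
  · calc _ ≤ d ^ α * t ^ α := by gcongr; exact min_le_right _ _
      _ = (d * t) ^ α := (Real.mul_rpow hd.le ht.le).symm
      _ ≤ x ^ α := Real.rpow_le_rpow_of_nonpos hx hxd h

/-- The lower Forelli–Rudin estimate, from the ball centred at `l` of radius `(1-|l|)/2`. -/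
lemma exists_le_integral_kernel {α s : ℝ} (hα : -1 < α) (hs : α + 2 < s) :
    ∃ c : ℝ, 0 < c ∧ ∀ l ∈ ball (0 : ℂ) 1, c * (1 - ‖l‖) ^ (α + 2 - s) ≤
      ∫ z in ball (0 : ℂ) 1,
        ‖(1 : ℂ) - (starRingEnd ℂ) l * z‖ ^ (-s) * (1 - ‖z‖ ^ 2) ^ α := by
  obtain ⟨_, -, h⟩ := exists_integral_kernel_le hα hs
  set m : ℝ := min ((1 / 2 : ℝ) ^ α) (3 ^ α) with hm
  have hm0 : 0 < m := lt_min (by positivity) (by positivity)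
  refine ⟨3 ^ (-s) * m * (Real.pi / 4), by have := Real.pi_pos; positivity, fun l hl => ?_⟩
  have hl1 : ‖l‖ < 1 := mem_ball_zero_iff.1 hl
  have hl0 := norm_nonneg l
  set t := 1 - ‖l‖ with ht
  have ht0 : 0 < t := by linarith
  have hnear : ∀ z ∈ ball l (t / 2), 1 - ‖z‖ < 3 / 2 * t ∧ t / 2 < 1 - ‖z‖ := by
    intro z hz
    rw [mem_ball, dist_eq_norm] at hz
    have h1 := norm_sub_norm_le z l
    have h2 := norm_sub_norm_le l z
    rw [norm_sub_rev] at h2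
    constructor <;> linarith
  have hsub : ball l (t / 2) ⊆ ball (0 : ℂ) 1 := fun z hz => by
    rw [mem_ball_zero_iff]
    linarith [(hnear z hz).2]
  have hpt : ∀ z ∈ ball l (t / 2), 3 ^ (-s) * m * t ^ (α - s) ≤
      ‖(1 : ℂ) - (starRingEnd ℂ) l * z‖ ^ (-s) * (1 - ‖z‖ ^ 2) ^ α := by
    intro z hz
    obtain ⟨hz1, hz2⟩ := hnear z hz
    have hz0 := norm_nonneg z
    have hup : ‖(1 : ℂ) - (starRingEnd ℂ) l * z‖ ≤ 3 * t := by
      have heq : (1 : ℂ) - (starRingEnd ℂ) l * z =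
          ((1 - ‖l‖ ^ 2 : ℝ) : ℂ) - (starRingEnd ℂ) l * (z - l) := by
        push_cast
        rw [← Complex.conj_mul']
        ring
      rw [heq]
      refine (norm_sub_le _ _).trans ?_
      rw [mem_ball, dist_eq_norm] at hz
      rw [norm_mul, RCLike.norm_conj, Complex.norm_real, Real.norm_of_nonneg (by nlinarith)]
      nlinarith [norm_nonneg (z - l)]
    have hlow : 0 < ‖(1 : ℂ) - (starRingEnd ℂ) l * z‖ := by
      have := norm_sub_norm_le (1 : ℂ) ((starRingEnd ℂ) l * z)
      rw [norm_one, norm_mul, RCLike.norm_conj] at this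
      nlinarith
    have hker := Real.rpow_le_rpow_of_nonpos hlow hup (by linarith : -s ≤ 0)
    rw [Real.mul_rpow (by norm_num) ht0.le] at hker
    have hw : m * t ^ α ≤ (1 - ‖z‖ ^ 2) ^ α :=
      min_mul_rpow_le ht0 (by norm_num) (by nlinarith) (by nlinarith)
    calc 3 ^ (-s) * m * t ^ (α - s) = (3 ^ (-s) * t ^ (-s)) * (m * t ^ α) := by
          rw [show α - s = -s + α by ring, Real.rpow_add ht0]
          ring
      _ ≤ _ := by gcongr
  have hvol : volume.real (ball l (t / 2)) = Real.pi / 4 * t ^ (2 : ℝ) := by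
    rw [Measure.real, Complex.volume_ball, ENNReal.toReal_mul, ENNReal.toReal_pow,
      ENNReal.toReal_ofReal (by positivity), Real.rpow_two]
    simp only [ENNReal.coe_toReal, NNReal.coe_real_pi]
    ring
  calc 3 ^ (-s) * m * (Real.pi / 4) * t ^ (α + 2 - s)
      = ∫ _ in ball l (t / 2), 3 ^ (-s) * m * t ^ (α - s) := by
        rw [setIntegral_const, hvol, show α + 2 - s = (α - s) + 2 by ring, Real.rpow_add ht0,
          smul_eq_mul]
        ring
    _ ≤ ∫ z in ball l (t / 2),
          ‖(1 : ℂ) - (starRingEnd ℂ) l * z‖ ^ (-s) * (1 - ‖z‖ ^ 2) ^ α :=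
        setIntegral_mono_on (integrableOn_const measure_ball_lt_top.ne)
          ((h l hl).1.mono_set hsub) measurableSet_ball hpt
    _ ≤ _ := by
        refine setIntegral_mono_set (h l hl).1 ?_ hsub.eventuallyLE
        filter_upwards [ae_restrict_mem measurableSet_ball] with z hz
        exact kernel_nonneg hz _ s α

lemma norm_deriv_one_sub_mul_cpow {l z : ℂ} (hlz : ‖l * z‖ < 1) (β : ℝ) (hβ : 0 ≤ 1 + β) :
    ‖deriv (fun w => ((1 : ℂ) - l * w) ^ (-(1 + (β : ℂ)))) z‖ =
      (1 + β) * ‖l‖ * ‖(1 : ℂ) - l * z‖ ^ (-(2 + β)) := by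
  have hslit : (1 : ℂ) - l * z ∈ Complex.slitPlane := by
    refine Or.inl ?_
    rw [Complex.sub_re, Complex.one_re]
    linarith [Complex.re_le_norm (l * z)]
  have hd : HasDerivAt (fun w => (1 : ℂ) - l * w) (-l) z := by
    simpa using ((hasDerivAt_id z).const_mul l).const_sub 1
  rw [(hd.cpow_const hslit).deriv, norm_mul, norm_mul, norm_neg, norm_neg,
    show -(1 + (β : ℂ)) - 1 = ((-(2 + β) : ℝ) : ℂ) by push_cast; ring, Complex.norm_cpow_real,
    show (1 + (β : ℂ)) = ((1 + β : ℝ) : ℂ) by push_cast; ring, Complex.norm_real,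
    Real.norm_of_nonneg hβ]
  ring

lemma integral_norm_deriv_rpow_eq {l : ℂ} (hl : l ∈ ball (0 : ℂ) 1) {p α β : ℝ} (hβ : 0 ≤ β) :
    ∫ z in ball (0 : ℂ) 1,
        ‖deriv (fun w => ((1 : ℂ) - (starRingEnd ℂ) l * w) ^ (-(1 + (β : ℂ)))) z‖ ^ p *
          ((1 + α) * (1 - ‖z‖ ^ 2) ^ α) =
      (1 + α) * (1 + β) ^ p * ‖l‖ ^ p * ∫ z in ball (0 : ℂ) 1,
        ‖(1 : ℂ) - (starRingEnd ℂ) l * z‖ ^ (-(p * (2 + β))) * (1 - ‖z‖ ^ 2) ^ α := by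
  rw [← integral_const_mul]
  refine setIntegral_congr_fun measurableSet_ball fun z hz => ?_
  have hl1 : ‖l‖ < 1 := mem_ball_zero_iff.1 hl
  have hz1 : ‖z‖ < 1 := mem_ball_zero_iff.1 hz
  have hlz : ‖(starRingEnd ℂ) l * z‖ < 1 := by
    rw [norm_mul, RCLike.norm_conj]
    exact mul_lt_one_of_nonneg_of_lt_one_left (norm_nonneg _) hl1 hz1.le
  rw [norm_deriv_one_sub_mul_cpow hlz β (by linarith), RCLike.norm_conj,
    Real.mul_rpow (by positivity) (by positivity), Real.mul_rpow (by positivity) (by positivity),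
    ← Real.rpow_mul (norm_nonneg _), show -(2 + β) * p = -(p * (2 + β)) by ring]
  ring

/-- Norm of the test functions `F_{λ,β}(z) = (1-conj(λ)z)^{-(1+β)}` in `D^p_α`:
`‖F_{λ,β}‖_{D^p_α}^p ≍ (1-|λ|²)^{-pδ}` where `δ = 2+β-(2+α)/p > 0`. -/
theorem test_function_norm (p α β : ℝ) (hp : 1 ≤ p) (hα : -1 < α) (hβ : 0 ≤ β)
    (hδ : 0 < 2 + β - (2 + α) / p) :
    ∃ C₁ C₂ : ℝ, 0 < C₁ ∧ 0 < C₂ ∧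
      ∀ l ∈ ball (0:ℂ) 1,
        C₁ * (1 - ‖l‖ ^ 2) ^ (-(p * (2 + β - (2 + α) / p))) ≤
            ‖((1 : ℂ) - (starRingEnd ℂ) l * 0) ^ (-(1 + (β : ℂ)))‖ ^ p +
              (1 / Real.pi) * ∫ z in ball (0:ℂ) 1,
                ‖deriv (fun w => ((1 : ℂ) - (starRingEnd ℂ) l * w) ^ (-(1 + (β : ℂ)))) z‖ ^ p *
                  ((1 + α) * (1 - ‖z‖ ^ 2) ^ α) ∧
          ‖((1 : ℂ) - (starRingEnd ℂ) l * 0) ^ (-(1 + (β : ℂ)))‖ ^ p +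
              (1 / Real.pi) * ∫ z in ball (0:ℂ) 1,
                ‖deriv (fun w => ((1 : ℂ) - (starRingEnd ℂ) l * w) ^ (-(1 + (β : ℂ)))) z‖ ^ p *
                  ((1 + α) * (1 - ‖z‖ ^ 2) ^ α) ≤
            C₂ * (1 - ‖l‖ ^ 2) ^ (-(p * (2 + β - (2 + α) / p))) := by
  have hexp : p * (2 + β - (2 + α) / p) = p * (2 + β) - (α + 2) := by
    field_simp
    ring
  have hp0 : 0 < p := by linarith
  have hc : 0 < p * (2 + β) - (α + 2) := hexp ▸ mul_pos hp0 hδ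
  rw [hexp]
  set s := p * (2 + β) with hs
  have hαs : α + 2 < s := by linarith
  obtain ⟨C, hC, hupper⟩ := exists_integral_kernel_le hα hαs
  obtain ⟨c, hc0, hlower⟩ := exists_le_integral_kernel hα hαs
  have hα0 : 0 < 1 + α := by linarith
  have hpi := Real.pi_pos
  set K : ℝ := 1 / Real.pi * ((1 + α) * (1 + β) ^ p) with hK
  have hK0 : 0 < K := by positivity
  refine ⟨min ((3 / 4) ^ (s - (α + 2))) (K * (1 / 2) ^ p * c),
    1 + K * (C * 2 ^ (s - (α + 2))), by positivity, by positivity, fun l hl => ?_⟩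
  have hl1 : ‖l‖ < 1 := mem_ball_zero_iff.1 hl
  have hl0 := norm_nonneg l
  have ht : 0 < 1 - ‖l‖ := by linarith
  have hT : 0 < 1 - ‖l‖ ^ 2 := by nlinarith
  rw [integral_norm_deriv_rpow_eq hl hβ, ← hs]
  set I := ∫ z in ball (0 : ℂ) 1,
    ‖(1 : ℂ) - (starRingEnd ℂ) l * z‖ ^ (-s) * (1 - ‖z‖ ^ 2) ^ α with hI
  have hzero : ‖((1 : ℂ) - (starRingEnd ℂ) l * 0) ^ (-(1 + (β : ℂ)))‖ ^ p = 1 := by simp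
  have hassoc : 1 / Real.pi * ((1 + α) * (1 + β) ^ p * ‖l‖ ^ p * I) = K * (‖l‖ ^ p * I) := by
    rw [hK]; ring
  rw [hzero, hassoc]
  have hup := (hupper l hl).2
  have hlow := hlower l hl
  have hneg : α + 2 - s = -(s - (α + 2)) := by ring
  rw [hneg] at hup hlow
  have hI0 : 0 ≤ I := le_trans (by positivity) hlow
  have hTt : (1 - ‖l‖) ^ (-(s - (α + 2))) ≤
      2 ^ (s - (α + 2)) * (1 - ‖l‖ ^ 2) ^ (-(s - (α + 2))) := by
    refine (Real.rpow_le_rpow_of_nonpos (by positivity)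
      (by nlinarith : (1 - ‖l‖ ^ 2) / 2 ≤ 1 - ‖l‖) (by linarith)).trans (le_of_eq ?_)
    rw [Real.div_rpow hT.le (by norm_num), Real.rpow_neg (by norm_num : (0 : ℝ) ≤ 2),
      div_inv_eq_mul, mul_comm]
  have htT : (1 - ‖l‖ ^ 2) ^ (-(s - (α + 2))) ≤ (1 - ‖l‖) ^ (-(s - (α + 2))) :=
    Real.rpow_le_rpow_of_nonpos ht (by nlinarith) (by linarith)
  constructor
  · rcases lt_or_ge ‖l‖ (1 / 2) with h | h
    · have hT34 := Real.rpow_le_rpow_of_nonpos (by norm_num : (0 : ℝ) < 3 / 4)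
        (by nlinarith : 3 / 4 ≤ 1 - ‖l‖ ^ 2) (by linarith : -(s - (α + 2)) ≤ 0)
      calc _ ≤ (3 / 4 : ℝ) ^ (s - (α + 2)) * (3 / 4) ^ (-(s - (α + 2))) := by
            gcongr
            exact min_le_left _ _
        _ = 1 := by rw [← Real.rpow_add (by norm_num), add_neg_cancel, Real.rpow_zero]
        _ ≤ _ := le_add_of_nonneg_right (by positivity)
    · calc _ ≤ K * (1 / 2) ^ p * c * (1 - ‖l‖) ^ (-(s - (α + 2))) := by
            gcongr
            exact min_le_right _ _
        _ = K * ((1 / 2) ^ p * (c * (1 - ‖l‖) ^ (-(s - (α + 2))))) := by ring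
        _ ≤ K * (‖l‖ ^ p * I) := by gcongr
        _ ≤ _ := le_add_of_nonneg_left zero_le_one
  · have hone : 1 ≤ (1 - ‖l‖ ^ 2) ^ (-(s - (α + 2))) :=
      Real.one_le_rpow_of_pos_of_le_one_of_nonpos hT (by nlinarith) (by linarith)
    have hlp : ‖l‖ ^ p ≤ 1 := Real.rpow_le_one hl0 hl1.le hp0.le
    calc 1 + K * (‖l‖ ^ p * I)
        ≤ (1 - ‖l‖ ^ 2) ^ (-(s - (α + 2))) +
          K * (1 * (C * (2 ^ (s - (α + 2)) * (1 - ‖l‖ ^ 2) ^ (-(s - (α + 2)))))) := by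
          gcongr
          exact hup.trans (by gcongr)
      _ = _ := by ring
end

section
/- Let φ be a holomorphic self-map of the unit disc belonging to the Dirichlet space. If sup_{n≥1} D(φⁿ) < ∞, then the composition operator C_φ(f) = f∘φ is bounded on the Dirichlet space. -/
open MeasureTheory Metric

/-- Rotations about the origin preserve area integrals. -/
lemma lintegral_comp_circleMap_mul (F : ℂ → ENNReal) (θ : ℝ) :
    ∫⁻ v, F (circleMap 0 1 θ * v) = ∫⁻ v, F v := by
  have h := (rotation (Circle.exp θ)).measurePreserving.lintegral_comp_emb
    (rotation (Circle.exp θ)).toHomeomorph.measurableEmbedding F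
  simpa [rotation_apply, circleMap] using h

/-- The mean value property for `g ^ 2`, as an upper bound for `‖g w‖ ^ 2`. -/
lemma enorm_sq_mul_two_pi_le_lintegral_circle {g : ℂ → ℂ} {w v : ℂ} {R : ℝ}
    (hg : DifferentiableOn ℂ g (ball w R)) (hv : v ∈ ball (0 : ℂ) R) :
    ‖g w‖ₑ ^ 2 * ENNReal.ofReal (2 * Real.pi) ≤
      ∫⁻ θ in Set.Ioc 0 (2 * Real.pi), ‖g (w + circleMap 0 1 θ * v)‖ₑ ^ 2 := by
  have hmaps : Set.MapsTo (fun ζ : ℂ => w + ζ * v) (closedBall 0 1) (ball w R) := by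
    intro ζ hζ
    simp only [mem_closedBall, dist_zero_right, mem_ball, dist_self_add_left, norm_mul] at hζ hv ⊢
    nlinarith [norm_nonneg v]
  have hd : DifferentiableOn ℂ (fun ζ => g (w + ζ * v) ^ 2) (closedBall 0 1) :=
    (hg.comp (by fun_prop) hmaps).pow 2
  have havg : Real.circleAverage (fun ζ => g (w + ζ * v) ^ 2) 0 1 = g w ^ 2 := by
    have h : DiffContOnCl ℂ (fun ζ => g (w + ζ * v) ^ 2) (ball 0 |(1 : ℝ)|) := by
      apply DifferentiableOn.diffContOnCl
      rw [abs_one, closure_ball _ one_ne_zero]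
      exact hd
    simpa using h.circleAverage
  have hpi : (0 : ℝ) < 2 * Real.pi := Real.two_pi_pos
  have hint : ∫ θ in Set.Ioc 0 (2 * Real.pi), g (w + circleMap 0 1 θ * v) ^ 2
      = (2 * Real.pi) • g w ^ 2 := by
    rw [← intervalIntegral.integral_of_le hpi.le, ← havg, Real.circleAverage_def,
      smul_inv_smul₀ hpi.ne']
  calc ‖g w‖ₑ ^ 2 * ENNReal.ofReal (2 * Real.pi)
      = ‖(2 * Real.pi) • g w ^ 2‖ₑ := by
        rw [enorm_smul, Real.enorm_of_nonneg hpi.le, enorm_pow, mul_comm]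
    _ ≤ ∫⁻ θ in Set.Ioc 0 (2 * Real.pi), ‖g (w + circleMap 0 1 θ * v) ^ 2‖ₑ := by
        rw [← hint]; exact enorm_integral_le_lintegral_enorm _
    _ = _ := by simp only [enorm_pow]

lemma ContinuousOn.measurable_indicator_ball {f : ℂ → ℂ} {c : ℂ} {r : ℝ}
    (hf : ContinuousOn f (ball c r)) : Measurable ((ball c r).indicator f) := by
  classical
  exact hf.measurable_piecewise continuousOn_const measurableSet_ball

/-- The area submean value property of `‖g‖ ^ 2` for holomorphic `g`. -/
lemma enorm_sq_mul_volume_ball_le {g : ℂ → ℂ} {w : ℂ} {R : ℝ}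
    (hg : DifferentiableOn ℂ g (ball w R)) :
    ‖g w‖ₑ ^ 2 * volume (ball w R) ≤ ∫⁻ ζ in ball w R, ‖g ζ‖ₑ ^ 2 := by
  set H : ℂ → ENNReal := (ball w R).indicator (fun ζ => ‖g ζ‖ₑ ^ 2) with hH
  have hHm : Measurable H := by
    have h2 : H = fun ζ => ‖(ball w R).indicator g ζ‖ₑ ^ 2 := by
      ext ζ
      by_cases h : ζ ∈ ball w R <;> simp [hH, h]
    rw [h2]
    exact hg.continuousOn.measurable_indicator_ball.enorm.pow_const 2
  have hpi : (0 : ℝ) < 2 * Real.pi := Real.two_pi_pos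
  have hc0 : ENNReal.ofReal (2 * Real.pi) ≠ 0 := by simpa using hpi
  have key : ENNReal.ofReal (2 * Real.pi) * (‖g w‖ₑ ^ 2 * volume (ball w R)) ≤
      ENNReal.ofReal (2 * Real.pi) * ∫⁻ ζ in ball w R, ‖g ζ‖ₑ ^ 2 := by
    calc ENNReal.ofReal (2 * Real.pi) * (‖g w‖ₑ ^ 2 * volume (ball w R))
        = ∫⁻ _ in ball (0 : ℂ) R, ‖g w‖ₑ ^ 2 * ENNReal.ofReal (2 * Real.pi) := by
          rw [setLIntegral_const, Complex.volume_ball, Complex.volume_ball]; ring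
      _ ≤ ∫⁻ v in ball (0 : ℂ) R, ∫⁻ θ in Set.Ioc 0 (2 * Real.pi),
            H (w + circleMap 0 1 θ * v) := by
          refine setLIntegral_mono' measurableSet_ball fun v hv => ?_
          refine (enorm_sq_mul_two_pi_le_lintegral_circle hg hv).trans_eq ?_
          refine lintegral_congr fun θ => ?_
          rw [hH, Set.indicator_of_mem]
          simpa using hv
      _ ≤ ∫⁻ v, ∫⁻ θ in Set.Ioc 0 (2 * Real.pi), H (w + circleMap 0 1 θ * v) :=
          setLIntegral_le_lintegral _ _
      _ = ∫⁻ θ in Set.Ioc 0 (2 * Real.pi), ∫⁻ v, H (w + circleMap 0 1 θ * v) := by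
          refine lintegral_lintegral_swap (Measurable.aemeasurable ?_)
          refine hHm.comp (Continuous.measurable ?_)
          have := continuous_circleMap 0 1
          fun_prop
      _ = ∫⁻ θ in Set.Ioc 0 (2 * Real.pi), ∫⁻ ζ, H ζ := by
          refine lintegral_congr fun θ => ?_
          rw [lintegral_comp_circleMap_mul (fun v => H (w + v)) θ, lintegral_add_left_eq_self]
      _ = _ := by
          rw [setLIntegral_const, Real.volume_Ioc, sub_zero, mul_comm, hH,
            lintegral_indicator measurableSet_ball]
  exact (ENNReal.mul_le_mul_iff_right hc0 ENNReal.ofReal_ne_top).1 key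

/-- Local growth bound for holomorphic functions on the disc. -/
lemma enorm_sq_le_lintegral_ball {g : ℂ → ℂ} (hg : DifferentiableOn ℂ g (ball 0 1))
    {w : ℂ} (hw : w ∈ ball (0 : ℂ) 1) :
    ‖g w‖ₑ ^ 2 ≤ ENNReal.ofReal (4 / (Real.pi * (1 - ‖w‖) ^ 2)) *
      ∫⁻ ζ in ball w ((1 - ‖w‖) / 2), ‖g ζ‖ₑ ^ 2 := by
  have hw' : 0 < 1 - ‖w‖ := by simpa using hw
  have hsub : ball w ((1 - ‖w‖) / 2) ⊆ ball 0 1 := by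
    apply ball_subset_ball'
    rw [dist_zero_right]; linarith
  have h := enorm_sq_mul_volume_ball_le (hg.mono hsub)
  have hvol : volume (ball w ((1 - ‖w‖) / 2)) =
      ENNReal.ofReal (Real.pi * (1 - ‖w‖) ^ 2 / 4) := by
    have hpi : (NNReal.pi : ENNReal) = ENNReal.ofReal Real.pi := by
      rw [← NNReal.coe_real_pi, ENNReal.ofReal_coe_nnreal]
    rw [Complex.volume_ball, hpi, ← ENNReal.ofReal_pow (by positivity),
      ← ENNReal.ofReal_mul (by positivity)]
    congr 1; ring
  rw [hvol] at h
  have hone : ENNReal.ofReal (4 / (Real.pi * (1 - ‖w‖) ^ 2)) *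
      ENNReal.ofReal (Real.pi * (1 - ‖w‖) ^ 2 / 4) = 1 := by
    rw [← ENNReal.ofReal_mul (by positivity), ← ENNReal.ofReal_one]
    congr 1
    have := Real.pi_pos
    field_simp
  calc ‖g w‖ₑ ^ 2 = ENNReal.ofReal (4 / (Real.pi * (1 - ‖w‖) ^ 2)) *
      (‖g w‖ₑ ^ 2 * ENNReal.ofReal (Real.pi * (1 - ‖w‖) ^ 2 / 4)) := by
        rw [mul_left_comm, hone, mul_one]
    _ ≤ _ := by gcongr

/-- On the part of the disc where `φ` is `2 δ`-close to the circle, the derivative of `φ` is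
controlled by that of a power of `φ` of order `1 / δ`. -/
lemma exists_norm_deriv_sq_le_deriv_pow {φ : ℂ → ℂ} (hφd : DifferentiableOn ℂ φ (ball 0 1))
    {δ : ℝ} (hδ : 0 < δ) : ∃ n : ℕ, 1 ≤ n ∧ ∀ z ∈ ball (0 : ℂ) 1, 1 - ‖φ z‖ ≤ 2 * δ →
      ‖deriv φ z‖ ^ 2 ≤ 128 * δ ^ 2 * ‖deriv (fun w => φ w ^ n) z‖ ^ 2 := by
  set k := ⌊1 / (8 * δ)⌋₊ with hk
  refine ⟨k + 1, by omega, fun z hz hzδ => ?_⟩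
  have hk1 : (k : ℝ) ≤ 1 / (8 * δ) := Nat.floor_le (by positivity)
  have hk2 : 1 / (8 * δ) < k + 1 := Nat.lt_floor_add_one _
  rw [div_lt_iff₀ (by positivity)] at hk2
  rw [le_div_iff₀ (by positivity)] at hk1
  have hdz : DifferentiableAt ℂ φ z := hφd.differentiableAt (isOpen_ball.mem_nhds hz)
  have hder : deriv (fun w => φ w ^ (k + 1)) z = (k + 1 : ℂ) * φ z ^ k * deriv φ z := by
    simpa using (hdz.hasDerivAt.fun_pow (k + 1)).deriv
  have hnk : ‖(k + 1 : ℂ)‖ = k + 1 := by exact_mod_cast Complex.norm_natCast (k + 1)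
  rw [hder, norm_mul, norm_mul, norm_pow, hnk]
  have hpow : 1 / 2 ≤ (‖φ z‖ ^ k) ^ 2 := by
    have hb := one_add_mul_le_pow (a := ‖φ z‖ - 1) (by linarith [norm_nonneg (φ z)]) (k * 2)
    rw [← pow_mul]
    rw [add_sub_cancel] at hb
    refine le_trans ?_ hb
    push_cast
    nlinarith [Nat.cast_nonneg (α := ℝ) k]
  have hsq : 1 ≤ 64 * δ ^ 2 * (k + 1 : ℝ) ^ 2 := by nlinarith
  calc ‖deriv φ z‖ ^ 2 = 2 * 1 * (1 / 2) * ‖deriv φ z‖ ^ 2 := by ring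
    _ ≤ 2 * (64 * δ ^ 2 * (k + 1 : ℝ) ^ 2) * (‖φ z‖ ^ k) ^ 2 * ‖deriv φ z‖ ^ 2 := by gcongr
    _ = _ := by ring

/-- The area, counted with multiplicity, that `φ` covers near the circle (at depth `2 δ`) is
`O(δ ^ 2)` when the powers of `φ` have bounded Dirichlet integrals. -/
lemma setLIntegral_enorm_deriv_sq_le {φ : ℂ → ℂ} (hφd : DifferentiableOn ℂ φ (ball 0 1))
    {M : ENNReal}
    (hM : ∀ n : ℕ, 1 ≤ n → ∫⁻ z in ball (0 : ℂ) 1, ‖deriv (fun w => φ w ^ n) z‖ₑ ^ 2 ≤ M)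
    {δ : ℝ} (hδ : 0 < δ) {A : Set ℂ} (hA : MeasurableSet A) (hAD : A ⊆ ball 0 1)
    (hAδ : ∀ z ∈ A, 1 - ‖φ z‖ ≤ 2 * δ) :
    ∫⁻ z in A, ‖deriv φ z‖ₑ ^ 2 ≤ ENNReal.ofReal (128 * δ ^ 2) * M := by
  obtain ⟨n, hn, h⟩ := exists_norm_deriv_sq_le_deriv_pow hφd hδ
  calc ∫⁻ z in A, ‖deriv φ z‖ₑ ^ 2
      ≤ ∫⁻ z in A, ENNReal.ofReal (128 * δ ^ 2) * ‖deriv (fun w => φ w ^ n) z‖ₑ ^ 2 := by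
        refine setLIntegral_mono' hA fun z hz => ?_
        have := ENNReal.ofReal_le_ofReal (h z (hAD hz) (hAδ z hz))
        rwa [ENNReal.ofReal_mul (by positivity), ENNReal.ofReal_pow (norm_nonneg _),
          ENNReal.ofReal_pow (norm_nonneg _), ofReal_norm, ofReal_norm] at this
    _ = ENNReal.ofReal (128 * δ ^ 2) * ∫⁻ z in A, ‖deriv (fun w => φ w ^ n) z‖ₑ ^ 2 :=
        lintegral_const_mul' _ _ ENNReal.ofReal_ne_top
    _ ≤ _ := by
        gcongr
        exact (lintegral_mono_set hAD).trans (hM n hn)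

/-- The Carleson-type embedding of the Bergman space induced by a self-map whose powers have
bounded Dirichlet integral. -/
lemma lintegral_comp_mul_deriv_le {φ : ℂ → ℂ} (hφd : DifferentiableOn ℂ φ (ball 0 1))
    (hφm : Set.MapsTo φ (ball 0 1) (ball 0 1)) {M : ENNReal}
    (hM : ∀ n : ℕ, 1 ≤ n → ∫⁻ z in ball (0 : ℂ) 1, ‖deriv (fun w => φ w ^ n) z‖ₑ ^ 2 ≤ M)
    {g : ℂ → ℂ} (hg : DifferentiableOn ℂ g (ball 0 1)) :
    ∫⁻ z in ball (0 : ℂ) 1, ‖g (φ z)‖ₑ ^ 2 * ‖deriv φ z‖ₑ ^ 2 ≤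
      ENNReal.ofReal (1152 / Real.pi) * M * ∫⁻ ζ in ball (0 : ℂ) 1, ‖g ζ‖ₑ ^ 2 := by
  set D := ball (0 : ℂ) 1 with hD
  set Φ := D.indicator φ
  set P := D.indicator (deriv φ)
  set G := D.indicator g
  have hΦ : Measurable Φ := hφd.continuousOn.measurable_indicator_ball
  have hP : Measurable P := (hφd.deriv isOpen_ball).continuousOn.measurable_indicator_ball
  have hG : Measurable G := hg.continuousOn.measurable_indicator_ball
  have hΦD : ∀ z ∈ D, Φ z = φ z := fun z hz => Set.indicator_of_mem hz _
  have hPD : ∀ z ∈ D, P z = deriv φ z := fun z hz => Set.indicator_of_mem hz _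
  have hGD : ∀ z ∈ D, G z = g z := fun z hz => Set.indicator_of_mem hz _
  set c : ℂ → ENNReal := fun z => ENNReal.ofReal (4 / (Real.pi * (1 - ‖Φ z‖) ^ 2)) with hc
  have hcm : Measurable c := by fun_prop
  set S : Set (ℂ × ℂ) := {p | dist p.2 (Φ p.1) < (1 - ‖Φ p.1‖) / 2} with hS
  have hSm : MeasurableSet S := measurableSet_lt (by fun_prop) (by fun_prop)
  set F : ℂ × ℂ → ENNReal :=
    S.indicator (fun p => ‖P p.1‖ₑ ^ 2 * c p.1 * ‖G p.2‖ₑ ^ 2) with hF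
  have hFm : Measurable F := Measurable.indicator (by fun_prop) hSm
  have hlow : ∀ z ∈ D, ‖g (φ z)‖ₑ ^ 2 * ‖deriv φ z‖ₑ ^ 2 ≤ ∫⁻ ζ in D, F (z, ζ) := by
    intro z hz
    have hsub : ball (φ z) ((1 - ‖φ z‖) / 2) ⊆ D := by
      have : ‖φ z‖ < 1 := by simpa [hD] using hφm hz
      apply ball_subset_ball'
      rw [dist_zero_right]; linarith
    calc ‖g (φ z)‖ₑ ^ 2 * ‖deriv φ z‖ₑ ^ 2
        ≤ (c z * ∫⁻ ζ in ball (φ z) ((1 - ‖φ z‖) / 2), ‖g ζ‖ₑ ^ 2) * ‖deriv φ z‖ₑ ^ 2 := by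
          gcongr
          simp only [hc, hΦD z hz]
          exact enorm_sq_le_lintegral_ball hg (hφm hz)
      _ = ∫⁻ ζ in ball (φ z) ((1 - ‖φ z‖) / 2), ‖P z‖ₑ ^ 2 * c z * ‖g ζ‖ₑ ^ 2 := by
          rw [lintegral_const_mul' _ _ (by finiteness), hPD z hz]; ring
      _ = ∫⁻ ζ in ball (φ z) ((1 - ‖φ z‖) / 2), F (z, ζ) := by
          refine setLIntegral_congr_fun measurableSet_ball fun ζ hζ => ?_
          have : (z, ζ) ∈ S := by simpa [hS, hΦD z hz] using hζ
          simp only [hF, Set.indicator_of_mem this, hGD ζ (hsub hζ)]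
      _ ≤ _ := lintegral_mono_set hsub
  have hup : ∀ ζ ∈ D, ∫⁻ z in D, F (z, ζ) ≤
      ENNReal.ofReal (1152 / Real.pi) * M * ‖g ζ‖ₑ ^ 2 := by
    intro ζ hζ
    set δ := 1 - ‖ζ‖ with hδ'
    have hδ : 0 < δ := by simpa [hD, hδ'] using hζ
    set A : Set ℂ := D ∩ {z | (z, ζ) ∈ S} with hA
    have hSζ : MeasurableSet {z | (z, ζ) ∈ S} := measurable_prodMk_right hSm
    have hdist : ∀ z ∈ A, ‖ζ‖ - ‖φ z‖ < (1 - ‖φ z‖) / 2 ∧ ‖φ z‖ - ‖ζ‖ < (1 - ‖φ z‖) / 2 := by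
      intro z hz
      have h : dist ζ (Φ z) < (1 - ‖Φ z‖) / 2 := hz.2
      rw [hΦD z hz.1, dist_eq_norm] at h
      exact ⟨(norm_sub_norm_le _ _).trans_lt h,
        (norm_sub_norm_le _ _).trans_lt (by rwa [norm_sub_rev])⟩
    calc ∫⁻ z in D, F (z, ζ)
        = ∫⁻ z in A, ‖P z‖ₑ ^ 2 * c z * ‖G ζ‖ₑ ^ 2 := by
          rw [hA, Set.inter_comm, ← setLIntegral_indicator hSζ]
          rfl
      _ ≤ ∫⁻ z in A, ENNReal.ofReal (9 / (Real.pi * δ ^ 2)) * ‖g ζ‖ₑ ^ 2 *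
            ‖deriv φ z‖ₑ ^ 2 := by
          refine setLIntegral_mono' (measurableSet_ball.inter hSζ) fun z hz => ?_
          have hcz : c z ≤ ENNReal.ofReal (9 / (Real.pi * δ ^ 2)) := by
            simp only [hc, hΦD z hz.1]
            apply ENNReal.ofReal_le_ofReal
            have h1 : 2 * δ ≤ 3 * (1 - ‖φ z‖) := by linarith [(hdist z hz).2]
            have h2 : 0 < 1 - ‖φ z‖ := by linarith
            rw [div_le_div_iff₀ (by positivity) (by positivity)]
            have h3 : (2 * δ) ^ 2 ≤ (3 * (1 - ‖φ z‖)) ^ 2 := by gcongr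
            nlinarith [Real.pi_pos]
          rw [hPD z hz.1, hGD ζ hζ]
          calc _ ≤ ‖deriv φ z‖ₑ ^ 2 * ENNReal.ofReal (9 / (Real.pi * δ ^ 2)) * ‖g ζ‖ₑ ^ 2 := by
                gcongr
            _ = _ := by ring
      _ = ENNReal.ofReal (9 / (Real.pi * δ ^ 2)) * ‖g ζ‖ₑ ^ 2 *
            ∫⁻ z in A, ‖deriv φ z‖ₑ ^ 2 := lintegral_const_mul' _ _ (by finiteness)
      _ ≤ ENNReal.ofReal (9 / (Real.pi * δ ^ 2)) * ‖g ζ‖ₑ ^ 2 *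
            (ENNReal.ofReal (128 * δ ^ 2) * M) := by
          gcongr
          exact setLIntegral_enorm_deriv_sq_le hφd hM hδ (measurableSet_ball.inter hSζ)
            Set.inter_subset_left fun z hz => by linarith [(hdist z hz).1]
      _ = ENNReal.ofReal (9 / (Real.pi * δ ^ 2)) * ENNReal.ofReal (128 * δ ^ 2) * M *
            ‖g ζ‖ₑ ^ 2 := by ring
      _ = _ := by
          rw [← ENNReal.ofReal_mul (by positivity)]
          congr 3
          field_simp
          norm_num
  calc ∫⁻ z in D, ‖g (φ z)‖ₑ ^ 2 * ‖deriv φ z‖ₑ ^ 2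
      ≤ ∫⁻ z in D, ∫⁻ ζ in D, F (z, ζ) := setLIntegral_mono' measurableSet_ball hlow
    _ = ∫⁻ ζ in D, ∫⁻ z in D, F (z, ζ) := lintegral_lintegral_swap hFm.aemeasurable
    _ ≤ ∫⁻ ζ in D, ENNReal.ofReal (1152 / Real.pi) * M * ‖g ζ‖ₑ ^ 2 :=
        setLIntegral_mono' measurableSet_ball hup
    _ = ∫⁻ ζ in D, ENNReal.ofReal (1152 / Real.pi) * M * ‖G ζ‖ₑ ^ 2 :=
        setLIntegral_congr_fun measurableSet_ball fun ζ hζ => by simp only [hGD ζ hζ]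
    _ = ENNReal.ofReal (1152 / Real.pi) * M * ∫⁻ ζ in D, ‖G ζ‖ₑ ^ 2 :=
        lintegral_const_mul _ (by fun_prop)
    _ = _ := by
        congr 1
        exact setLIntegral_congr_fun measurableSet_ball fun ζ hζ => by simp only [hGD ζ hζ]

lemma ofReal_integral_norm_sq {α : Type*} [MeasurableSpace α] {μ : Measure α} {f : α → ℂ}
    (hf : Integrable (fun z => ‖f z‖ ^ 2) μ) :
    ENNReal.ofReal (∫ z, ‖f z‖ ^ 2 ∂μ) = ∫⁻ z, ‖f z‖ₑ ^ 2 ∂μ := by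
  rw [ofReal_integral_eq_lintegral_ofReal hf (ae_of_all _ fun z => by positivity)]
  simp only [ENNReal.ofReal_pow (norm_nonneg _), ofReal_norm]

lemma integrable_norm_sq_of_lintegral_lt_top {α : Type*} [MeasurableSpace α] {μ : Measure α}
    {f : α → ℂ} (hf : AEStronglyMeasurable f μ) (h : ∫⁻ z, ‖f z‖ₑ ^ 2 ∂μ < ⊤) :
    Integrable (fun z => ‖f z‖ ^ 2) μ := by
  refine ⟨hf.norm.pow 2, ?_⟩
  simpa [HasFiniteIntegral, enorm_pow] using h

/-- Point evaluations are bounded on the Dirichlet space. -/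
lemma norm_sq_le_of_dirichlet {f : ℂ → ℂ} (hf : DifferentiableOn ℂ f (ball 0 1))
    (hfi : IntegrableOn (fun z => ‖deriv f z‖ ^ 2) (ball (0 : ℂ) 1)) {w : ℂ}
    (hw : w ∈ ball (0 : ℂ) 1) :
    ‖f w‖ ^ 2 ≤ 2 * ‖f 0‖ ^ 2 + 2 * (4 / (Real.pi * (1 - ‖w‖) ^ 2) *
      ∫ z in ball (0 : ℂ) 1, ‖deriv f z‖ ^ 2) := by
  have hw' : ‖w‖ < 1 := by simpa using hw
  set I := ∫ z in ball (0 : ℂ) 1, ‖deriv f z‖ ^ 2 with hI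
  have hI0 : 0 ≤ I := integral_nonneg fun z => by positivity
  set B := 4 / (Real.pi * (1 - ‖w‖) ^ 2) * I with hB
  have hB0 : 0 ≤ B := by have := Real.pi_pos; positivity
  have hsub : closedBall (0 : ℂ) ‖w‖ ⊆ ball 0 1 := closedBall_subset_ball hw'
  have hbound : ∀ u ∈ closedBall (0 : ℂ) ‖w‖, ‖deriv f u‖ ≤ √B := by
    intro u hu
    have huw : ‖u‖ ≤ ‖w‖ := by simpa using hu
    have hball : ball u ((1 - ‖u‖) / 2) ⊆ ball 0 1 := by
      apply ball_subset_ball'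
      rw [dist_zero_right]; linarith
    have h := (enorm_sq_le_lintegral_ball (hf.deriv isOpen_ball) (hsub hu)).trans
      (mul_le_mul_right (lintegral_mono_set hball) _)
    rw [← ofReal_integral_norm_sq hfi, ← hI, ← ENNReal.ofReal_mul (by positivity), ← ofReal_norm,
      ← ENNReal.ofReal_pow (norm_nonneg _), ENNReal.ofReal_le_ofReal_iff (by positivity)] at h
    refine Real.le_sqrt_of_sq_le (h.trans ?_)
    rw [hB]
    have := Real.pi_pos
    have : 0 < 1 - ‖w‖ := by linarith
    gcongr
  have hmv := (convex_closedBall (0 : ℂ) ‖w‖).norm_image_sub_le_of_norm_deriv_le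
    (fun u hu => hf.differentiableAt (isOpen_ball.mem_nhds (hsub hu))) hbound
    (x := 0) (y := w) (by simp) (by simp)
  rw [sub_zero] at hmv
  have h1 : ‖f w‖ ≤ ‖f 0‖ + √B := by
    have := norm_le_norm_add_norm_sub' (f w) (f 0)
    nlinarith [Real.sqrt_nonneg B]
  have h2 := Real.sq_sqrt hB0
  nlinarith [sq_nonneg (‖f 0‖ - √B), norm_nonneg (f w), pow_le_pow_left₀ (norm_nonneg _) h1 2]

/-- If `φ` is a holomorphic self-map of the disc in the Dirichlet space and
`sup_{n≥1} D(φⁿ) < ∞`, then the composition operator `C_φ` is bounded on the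
Dirichlet space. -/
theorem composition_bounded_of_sup_dirichlet (φ : ℂ → ℂ)
    (hφd : DifferentiableOn ℂ φ (ball (0:ℂ) 1))
    (hφm : Set.MapsTo φ (ball (0:ℂ) 1) (ball (0:ℂ) 1))
    (hφD : IntegrableOn (fun z => ‖deriv φ z‖ ^ 2) (ball (0:ℂ) 1))
    (hsup : ∃ M : ℝ, ∀ n : ℕ, 1 ≤ n →
      IntegrableOn (fun z => ‖deriv (fun w => φ w ^ n) z‖ ^ 2) (ball (0:ℂ) 1) ∧
      (1 / Real.pi) * ∫ z in ball (0:ℂ) 1, ‖deriv (fun w => φ w ^ n) z‖ ^ 2 ≤ M) :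
    ∃ C : ℝ, 0 < C ∧
      ∀ f : ℂ → ℂ, DifferentiableOn ℂ f (ball (0:ℂ) 1) →
        IntegrableOn (fun z => ‖deriv f z‖ ^ 2) (ball (0:ℂ) 1) →
        IntegrableOn (fun z => ‖deriv (f ∘ φ) z‖ ^ 2) (ball (0:ℂ) 1) ∧
        ‖(f ∘ φ) 0‖ ^ 2 + (1 / Real.pi) * ∫ z in ball (0:ℂ) 1, ‖deriv (f ∘ φ) z‖ ^ 2 ≤
          C * (‖f 0‖ ^ 2 + (1 / Real.pi) * ∫ z in ball (0:ℂ) 1, ‖deriv f z‖ ^ 2) := by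
  have hpi := Real.pi_pos
  obtain ⟨M, hM⟩ := hsup
  have hM0 : 0 ≤ M := le_trans
    (mul_nonneg (by positivity) (integral_nonneg fun z => by positivity)) (hM 1 le_rfl).2
  have hML : ∀ n : ℕ, 1 ≤ n → ∫⁻ z in ball (0 : ℂ) 1, ‖deriv (fun w => φ w ^ n) z‖ₑ ^ 2 ≤
      ENNReal.ofReal (Real.pi * M) := by
    intro n hn
    obtain ⟨hi, hle⟩ := hM n hn
    rw [← ofReal_integral_norm_sq hi]
    apply ENNReal.ofReal_le_ofReal
    rwa [one_div, inv_mul_le_iff₀ hpi] at hle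
  have h0 : φ 0 ∈ ball (0 : ℂ) 1 := hφm (mem_ball_self one_pos)
  have h0' : 0 < 1 - ‖φ 0‖ := by simpa using h0
  set a := 8 / (1 - ‖φ 0‖) ^ 2 with ha
  have ha0 : 0 < a := by positivity
  refine ⟨2 + a + 1152 * M, by positivity, fun f hf hfi => ?_⟩
  have hchain : ∀ z ∈ ball (0 : ℂ) 1, deriv (f ∘ φ) z = deriv f (φ z) * deriv φ z := fun z hz =>
    deriv_comp z (hf.differentiableAt (isOpen_ball.mem_nhds (hφm hz)))
      (hφd.differentiableAt (isOpen_ball.mem_nhds hz))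
  set I := ∫ z in ball (0 : ℂ) 1, ‖deriv f z‖ ^ 2 with hI
  have hI0 : 0 ≤ I := integral_nonneg fun z => by positivity
  have hL : ∫⁻ z in ball (0 : ℂ) 1, ‖deriv (f ∘ φ) z‖ₑ ^ 2 ≤ ENNReal.ofReal (1152 * M * I) := by
    have h := lintegral_comp_mul_deriv_le hφd hφm hML (hf.deriv isOpen_ball)
    rw [← ofReal_integral_norm_sq hfi, ← ENNReal.ofReal_mul (by positivity),
      ← ENNReal.ofReal_mul (by positivity)] at h
    have hconst : 1152 / Real.pi * (Real.pi * M) * I = 1152 * M * I := by field_simp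
    rw [← hI, hconst] at h
    refine (setLIntegral_congr_fun measurableSet_ball fun z hz => ?_).trans_le h
    simp only [hchain z hz, enorm_mul, mul_pow]
  have hint : IntegrableOn (fun z => ‖deriv (f ∘ φ) z‖ ^ 2) (ball (0 : ℂ) 1) := by
    refine integrable_norm_sq_of_lintegral_lt_top ?_ (hL.trans_lt ENNReal.ofReal_lt_top)
    exact ((hf.comp hφd hφm).deriv isOpen_ball).continuousOn.aestronglyMeasurable
      measurableSet_ball
  refine ⟨hint, ?_⟩
  rw [← ofReal_integral_norm_sq hint, ENNReal.ofReal_le_ofReal_iff (by positivity)] at hL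
  have hpt := norm_sq_le_of_dirichlet hf hfi h0
  have hpt' : ‖(f ∘ φ) 0‖ ^ 2 ≤ 2 * ‖f 0‖ ^ 2 + a * (1 / Real.pi * I) := by
    refine hpt.trans_eq ?_
    rw [ha]
    field_simp
    ring
  have hL' : 1 / Real.pi * ∫ z in ball (0 : ℂ) 1, ‖deriv (f ∘ φ) z‖ ^ 2 ≤
      1152 * M * (1 / Real.pi * I) := by
    calc _ ≤ 1 / Real.pi * (1152 * M * I) := by gcongr
      _ = _ := by ring
  have hJ : 0 ≤ 1 / Real.pi * I := by positivity
  have hs : 0 ≤ (a + 1152 * M) * ‖f 0‖ ^ 2 := by positivity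
  linarith
end
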